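/- arXiv:1102.2530 — 7 statements merged into one kernel-verified Lean document; each statement's English description precedes it below -/
import Mathlib

section
/- For all real numbers t and r with 1 < r < t, one has 2r²(−1 − 2t² + 3t⁴)·log r + (1 − r²)·(3(r² − t²)(t² − 1) + 2(1 + 3r²)·t²·log t) > 0. -/
theorem nitsche_aux : StrictAntiOn
    (fun x : ℝ => (x * Real.log x + x - 1) / ((x - 1) * (3 * x + 1))) (Set.Ioi 1) := by
  have hd : ∀ x : ℝ, 1 < x → HasDerivAt
      (fun x : ℝ => (x * Real.log x + x - 1) / ((x - 1) * (3 * x + 1)))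
      (((1 * Real.log x + x * x⁻¹ + 1) * ((x - 1) * (3 * x + 1))
        - (x * Real.log x + x - 1) * (1 * (3 * x + 1) + (x - 1) * (3 * 1)))
        / ((x - 1) * (3 * x + 1)) ^ 2) x := by
    intro x hx
    have h0 : x ≠ 0 := by linarith
    have hD : (x - 1) * (3 * x + 1) ≠ 0 :=
      (mul_pos (by linarith) (by linarith)).ne'
    have i := hasDerivAt_id' x
    exact (((i.mul (Real.hasDerivAt_log h0)).add i).sub_const 1).div
      ((i.sub_const 1).mul ((i.const_mul 3).add_const 1)) hD
  apply strictAntiOn_of_deriv_neg (convex_Ioi 1)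
  · intro x hx
    exact (hd x hx).continuousAt.continuousWithinAt
  · intro x hx
    rw [interior_Ioi] at hx
    have hx1 : 1 < x := hx
    rw [(hd x hx1).deriv]
    have h0 : x ≠ 0 := by linarith
    have hD : 0 < (x - 1) * (3 * x + 1) := mul_pos (by linarith) (by linarith)
    apply div_neg_of_neg_of_pos _ (by positivity)
    rw [mul_inv_cancel₀ h0]
    have hl := Real.one_sub_inv_le_log_of_pos (show 0 < x by linarith)
    have h2 : 4 * (x - 1) < (3 * x ^ 2 + 1) * (1 - x⁻¹) := by
      have : (3 * x ^ 2 + 1) * (1 - x⁻¹) - 4 * (x - 1) = (x - 1) ^ 2 * (3 * x - 1) / x := by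
        field_simp
        ring
      have : 0 < (x - 1) ^ 2 * (3 * x - 1) / x :=
        div_pos (mul_pos (pow_pos (by linarith) 2) (by linarith)) (by linarith)
      linarith
    have h3 : (3 * x ^ 2 + 1) * (1 - x⁻¹) ≤ (3 * x ^ 2 + 1) * Real.log x :=
      mul_le_mul_of_nonneg_left hl (by positivity)
    linarith

theorem nitsche_a (t r : ℝ) (hr : 1 < r) (hrt : r < t) :
    0 < 2 * r ^ 2 * (-1 - 2 * t ^ 2 + 3 * t ^ 4) * Real.log r
      + (1 - r ^ 2) * (3 * (r ^ 2 - t ^ 2) * (t ^ 2 - 1)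
          + 2 * (1 + 3 * r ^ 2) * t ^ 2 * Real.log t) := by
  have hx : 1 < r ^ 2 := by nlinarith
  have hxy : r ^ 2 < t ^ 2 := by nlinarith
  have hy : 1 < t ^ 2 := by linarith
  have h := nitsche_aux (Set.mem_Ioi.2 hx) (Set.mem_Ioi.2 hy) hxy
  simp only [Real.log_pow] at h
  rw [div_lt_div_iff₀ (mul_pos (by linarith) (by linarith))
    (mul_pos (by linarith) (by linarith))] at h
  push_cast at h
  linarith
end

section
/- For all real numbers t and r with 1 < r < t, one has (t² − 1)·(3(r² − 1)(t² − r²) + 2r²(1 + 3t²)·log r) + 2(1 + 2r² − 3r⁴)·t²·log t > 0. -/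
lemma aux_hasDeriv (x : ℝ) (hx : 1 < x) :
    HasDerivAt (fun x : ℝ => (x - 1 + x * Real.log x) / (3 * x ^ 2 - 2 * x - 1))
      ((4 * (x - 1) - Real.log x * (3 * x ^ 2 + 1)) / (3 * x ^ 2 - 2 * x - 1) ^ 2) x := by
  have hD : 3 * x ^ 2 - 2 * x - 1 ≠ 0 := by nlinarith
  have hx0 : x ≠ 0 := by linarith
  have h1 : HasDerivAt (fun x : ℝ => x - 1 + x * Real.log x)
      (1 + (1 * Real.log x + x * x⁻¹)) x :=
    ((hasDerivAt_id x).sub_const 1).add ((hasDerivAt_id x).mul (Real.hasDerivAt_log hx0))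
  have h2 : HasDerivAt (fun x : ℝ => 3 * x ^ 2 - 2 * x - 1) (3 * (2 * x) - 2 * 1) x := by
    have := (((hasDerivAt_pow 2 x).const_mul 3).sub ((hasDerivAt_id x).const_mul 2)).sub_const 1
    simpa using this
  refine (h1.div h2 hD).congr_deriv ?_
  rw [mul_inv_cancel₀ hx0]
  ring

lemma aux_neg (x : ℝ) (hx : 1 < x) :
    (4 * (x - 1) - Real.log x * (3 * x ^ 2 + 1)) / (3 * x ^ 2 - 2 * x - 1) ^ 2 < 0 := by
  have hD : 0 < 3 * x ^ 2 - 2 * x - 1 := by nlinarith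
  apply div_neg_of_neg_of_pos _ (by positivity)
  have h := Real.le_log_one_add_of_nonneg (x := x - 1) (by linarith)
  rw [div_le_iff₀ (by linarith)] at h
  have e : 1 + (x - 1) = x := by ring
  rw [e] at h
  have hL : 0 < Real.log x := Real.log_pos hx
  nlinarith [mul_pos hL hD]

theorem nitsche_c (t r : ℝ) (hr : 1 < r) (hrt : r < t) :
    0 < (t ^ 2 - 1) * (3 * (r ^ 2 - 1) * (t ^ 2 - r ^ 2)
          + 2 * r ^ 2 * (1 + 3 * t ^ 2) * Real.log r)
      + 2 * (1 + 2 * r ^ 2 - 3 * r ^ 4) * t ^ 2 * Real.log t := by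
  have hanti : StrictAntiOn
      (fun x : ℝ => (x - 1 + x * Real.log x) / (3 * x ^ 2 - 2 * x - 1)) (Set.Ioi 1) := by
    apply strictAntiOn_of_deriv_neg (convex_Ioi 1)
    · intro x hx
      exact (aux_hasDeriv x hx).continuousAt.continuousWithinAt
    · intro x hx
      rw [interior_Ioi] at hx
      rw [(aux_hasDeriv x hx).deriv]
      exact aux_neg x hx
  have ha : 1 < r ^ 2 := by nlinarith
  have hab : r ^ 2 < t ^ 2 := by nlinarith
  have hb : 1 < t ^ 2 := ha.trans hab
  have h := hanti (Set.mem_Ioi.2 ha) (Set.mem_Ioi.2 hb) hab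
  simp only at h
  rw [div_lt_div_iff₀ (by nlinarith) (by nlinarith), Real.log_pow, Real.log_pow] at h
  push_cast at h
  linarith
end

section
/- For all real numbers t and r with 1 < r < t, one has 2(r⁴ − t²)(t² − 1)·log r + (1 − r²)·((r² − t²)(t² − 1) + 2(r² − 1)·t²·log t) > 0. -/
theorem aux_log_lt (x : ℝ) (hx : 1 < x) : Real.log x < (x - x⁻¹) / 2 := by
  rw [← Real.sinh_log (by linarith)]
  exact Real.self_lt_sinh_iff.2 (Real.log_pos hx)

theorem aux_main (a b L M : ℝ) (ha : 1 < a) (hab : a < b)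
    (hL : L < (a - a⁻¹) / 2) (hM : M < (b / a - (b / a)⁻¹) / 2) :
    0 < (a ^ 2 - b) * (b - 1) * L + (a - 1) * (b - a) * (b - 1)
      - (a - 1) ^ 2 * b * (L + M) := by
  have h1 : 0 < (b - a) ^ 2 * ((a - a⁻¹) / 2 - L) :=
    mul_pos (pow_pos (by linarith) 2) (by linarith)
  have h2 : 0 < (a - 1) ^ 2 * b * ((b / a - (b / a)⁻¹) / 2 - M) :=
    mul_pos (mul_pos (pow_pos (by linarith) 2) (by linarith)) (by linarith)
  have h3 : (a ^ 2 - b) * (b - 1) * L + (a - 1) * (b - a) * (b - 1)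
      - (a - 1) ^ 2 * b * (L + M) = (b - a) ^ 2 * ((a - a⁻¹) / 2 - L)
      + (a - 1) ^ 2 * b * ((b / a - (b / a)⁻¹) / 2 - M) := by
    have : a ≠ 0 := by linarith
    have : b ≠ 0 := by linarith
    field_simp
    ring
  linarith

theorem nitsche_d (t r : ℝ) (hr : 1 < r) (hrt : r < t) :
    0 < 2 * (r ^ 4 - t ^ 2) * (t ^ 2 - 1) * Real.log r
      + (1 - r ^ 2) * ((r ^ 2 - t ^ 2) * (t ^ 2 - 1)
          + 2 * (r ^ 2 - 1) * t ^ 2 * Real.log t) := by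
  have ha : 1 < r ^ 2 := by nlinarith
  have hab : r ^ 2 < t ^ 2 := by nlinarith
  have hs : 1 < t ^ 2 / r ^ 2 := by rw [lt_div_iff₀ (by linarith)]; linarith
  have h := aux_main (r ^ 2) (t ^ 2) _ _ ha hab (aux_log_lt _ ha) (aux_log_lt _ hs)
  rw [Real.log_div (by linarith) (by linarith), Real.log_pow, Real.log_pow] at h
  push_cast at h
  linarith
end

section
/- Fix t > 1 and real numbers s, x, y. Suppose g(r) = d/r + a·r + b·r·log r + c·r³ (with real constants a, b, c, d) satisfies g(1) = 1, g(t) = s, g'(1) = x and g'(t) = y. Then for all r ∈ [1, t] one has g(r) = A(r) + B(r)·s + U(r)·x + V(r)·y, where A(r) = [(3 + r²)(r² − t²)(t² − 1) + 2r²(3 − 2t² − t⁴)·log r + 2(r⁴ + t⁴ + r²(t⁴ − 3))·log t] / (r·D), B(r) = [2r²(3t⁴ − 2t² − 1)·log r − (r² − 1)·((t² − 1)(r² + 3t²) + 2(r² − 1)·t²·log t)] / (r·t·D), U(r) = [−2r²(t² − 1)²·log r + (r² − 1)·((r² − t²)(t² − 1) − 2(r² − t⁴)·log t)] / (r·D),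 V(r) = [−2r²(t² − 1)²·log r + (r² − 1)·(−(r² − t²)(t² − 1) + 2(r² − 1)·t²·log t)] / (r·D), and D = 4(t² − 1)(1 − t² + (1 + t²)·log t). In particular h(r) = A(r) + B(r)·s satisfies h(1) = 1, h(t) = s, h'(1) = 0, h'(t) = 0. -/
open Real Set

/-- `D = 4(t² − 1)(1 − t² + (1 + t²) log t)`. -/
noncomputable def Dd (t : ℝ) : ℝ := 4 * (t ^ 2 - 1) * (1 - t ^ 2 + (1 + t ^ 2) * Real.log t)

noncomputable def funA (t r : ℝ) : ℝ :=
  ((3 + r ^ 2) * (r ^ 2 - t ^ 2) * (t ^ 2 - 1)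
    + 2 * r ^ 2 * (3 - 2 * t ^ 2 - t ^ 4) * Real.log r
    + 2 * (r ^ 4 + t ^ 4 + r ^ 2 * (t ^ 4 - 3)) * Real.log t) / (r * Dd t)

noncomputable def funB (t r : ℝ) : ℝ :=
  (2 * r ^ 2 * (3 * t ^ 4 - 2 * t ^ 2 - 1) * Real.log r
    - (r ^ 2 - 1) * ((t ^ 2 - 1) * (r ^ 2 + 3 * t ^ 2)
        + 2 * (r ^ 2 - 1) * t ^ 2 * Real.log t)) / (r * t * Dd t)

noncomputable def funU (t r : ℝ) : ℝ :=
  (-2 * r ^ 2 * (t ^ 2 - 1) ^ 2 * Real.log r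
    + (r ^ 2 - 1) * ((r ^ 2 - t ^ 2) * (t ^ 2 - 1)
        - 2 * (r ^ 2 - t ^ 4) * Real.log t)) / (r * Dd t)

noncomputable def funV (t r : ℝ) : ℝ :=
  (-2 * r ^ 2 * (t ^ 2 - 1) ^ 2 * Real.log r
    + (r ^ 2 - 1) * (-((r ^ 2 - t ^ 2) * (t ^ 2 - 1))
        + 2 * (r ^ 2 - 1) * t ^ 2 * Real.log t)) / (r * Dd t)

theorem Dd_pos_aux {t : ℝ} (ht : 1 < t) : 0 < 1 - t ^ 2 + (1 + t ^ 2) * Real.log t := by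
  have h := Real.lt_log_one_add_of_pos (x := t ^ 2 - 1) (by nlinarith)
  have e : (1 : ℝ) + (t ^ 2 - 1) = t ^ 2 := by ring
  rw [e, Real.log_pow, div_lt_iff₀ (by nlinarith)] at h
  push_cast at h
  nlinarith

theorem radial_hasDerivAt (a b c d r : ℝ) (hr : 0 < r) :
    HasDerivAt (fun r : ℝ => d / r + a * r + b * r * Real.log r + c * r ^ 3)
      (-d / r ^ 2 + a + b * (Real.log r + 1) + 3 * c * r ^ 2) r := by
  have hr' := hr.ne'
  have h1 := (hasDerivAt_inv hr').const_mul d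
  have h2 := (hasDerivAt_id r).const_mul a
  have h3 := ((hasDerivAt_id r).const_mul b).mul (Real.hasDerivAt_log hr')
  have h4 := (hasDerivAt_pow 3 r).const_mul c
  have h := ((h1.add h2).add h3).add h4
  refine (h.congr_deriv ?_).congr_of_eventuallyEq ?_
  · simp
    field_simp
  · refine Filter.Eventually.of_forall fun z => ?_
    simp [div_eq_mul_inv]

theorem AB_radial (t s r : ℝ) (ht : t ≠ 0) (hD : Dd t ≠ 0) :
    funA t r + funB t r * s =
      ((-3 * t ^ 2 * (t ^ 2 - 1) + 2 * t ^ 4 * Real.log t) / Dd t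
        - (-3 * t ^ 2 * (t ^ 2 - 1) + 2 * t ^ 2 * Real.log t) / (t * Dd t) * s) / r
      + (((t ^ 2 - 1) * (3 - t ^ 2) + 2 * (t ^ 4 - 3) * Real.log t) / Dd t
        - ((t ^ 2 - 1) * (3 * t ^ 2 - 1) - 4 * t ^ 2 * Real.log t) / (t * Dd t) * s) * r
      + (2 * (3 - 2 * t ^ 2 - t ^ 4) / Dd t
        + 2 * (3 * t ^ 4 - 2 * t ^ 2 - 1) / (t * Dd t) * s) * r * Real.log r
      + (((t ^ 2 - 1) + 2 * Real.log t) / Dd t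
        - ((t ^ 2 - 1) + 2 * t ^ 2 * Real.log t) / (t * Dd t) * s) * r ^ 3 := by
  unfold funA funB
  by_cases hr : r = 0
  · subst hr; simp
  · field_simp
    ring

/-- Lemma 3.2 (Lemma `abuv`): decomposition of the radial part of a bi-harmonic map into
boundary-data components. -/
theorem radial_biharmonic_decomposition
    (t s x y a b c d : ℝ) (ht : 1 < t)
    (g : ℝ → ℝ)
    (hgdef : ∀ r : ℝ, g r = d / r + a * r + b * r * Real.log r + c * r ^ 3)
    (hg1 : g 1 = 1) (hgt : g t = s)
    (hg'1 : deriv g 1 = x) (hg't : deriv g t = y) :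
    (∀ r ∈ Icc (1 : ℝ) t,
        g r = funA t r + funB t r * s + funU t r * x + funV t r * y) ∧
    (funA t 1 + funB t 1 * s = 1) ∧
    (funA t t + funB t t * s = s) ∧
    deriv (fun r => funA t r + funB t r * s) 1 = 0 ∧
    deriv (fun r => funA t r + funB t r * s) t = 0 := by
  have ht0 : 0 < t := by linarith
  have htn := ht0.ne'
  have hE := Dd_pos_aux ht
  have ht1 : 0 < t ^ 2 - 1 := by nlinarith
  have hD : Dd t ≠ 0 := by unfold Dd; positivity
  have hgf : g = fun r : ℝ => d / r + a * r + b * r * Real.log r + c * r ^ 3 := funext hgdef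
  have hABf : (fun r => funA t r + funB t r * s) = _ :=
    funext fun r => AB_radial t s r htn hD
  have hDe : Dd t = 4 * (t ^ 2 - 1) * (1 - t ^ 2 + (1 + t ^ 2) * Real.log t) := rfl
  refine ⟨?_, ?_, ?_, ?_, ?_⟩
  · intro r hr
    have hr0 : r ≠ 0 := by linarith [hr.1]
    rw [hgf, (radial_hasDerivAt a b c d 1 one_pos).deriv] at hg'1
    rw [hgf, (radial_hasDerivAt a b c d t ht0).deriv] at hg't
    rw [hgdef] at hg1 hgt
    simp only [Real.log_one] at hg1 hg'1
    have hone : funA t r = funA t r * (d / 1 + a * 1 + b * 1 * 0 + c * 1 ^ 3) := by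
      rw [hg1, mul_one]
    rw [hgdef, hone, ← hgt, ← hg'1, ← hg't]
    unfold funA funB funU funV
    field_simp
    rw [hDe]
    ring
  · unfold funA funB
    simp only [Real.log_one]
    field_simp
    rw [hDe]
    ring
  · unfold funA funB
    field_simp
    rw [hDe]
    ring
  · rw [hABf, (radial_hasDerivAt _ _ _ _ 1 one_pos).deriv]
    simp only [Real.log_one]
    field_simp
    ring
  · rw [hABf, (radial_hasDerivAt _ _ _ _ t ht0).deriv]
    field_simp
    ring
end

section
/- Fix t > 1. Then B'(r) > 0 for all r with 1 < r < t. -/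
open Real Set

/-- `A'(r)`. -/
noncomputable def A' (t r : ℝ) : ℝ :=
  (2 * r ^ 2 * (3 - 2 * t ^ 2 - t ^ 4) * Real.log r
    + (r ^ 2 - 1) * (3 * (r ^ 2 - t ^ 2) * (t ^ 2 - 1)
        + 2 * (3 * r ^ 2 + t ^ 4) * Real.log t)) / (r ^ 2 * Dd t)

/-- `B'(r)`. -/
noncomputable def B' (t r : ℝ) : ℝ :=
  (2 * r ^ 2 * (3 * t ^ 4 - 2 * t ^ 2 - 1) * Real.log r
    + (1 - r ^ 2) * (3 * (r ^ 2 - t ^ 2) * (t ^ 2 - 1)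
        + 2 * (1 + 3 * r ^ 2) * t ^ 2 * Real.log t)) / (r ^ 2 * t * Dd t)

/-- `U'(r)`. -/
noncomputable def U' (t r : ℝ) : ℝ :=
  ((1 + 3 * r ^ 2) * (r ^ 2 - t ^ 2) * (t ^ 2 - 1)
    + 2 * r ^ 2 * (1 - t ^ 2) ^ 2 * Real.log r
    - 2 * (3 * r ^ 4 - t ^ 4 - r ^ 2 * (1 + t ^ 4)) * Real.log t) / (r ^ 2 * Dd t)

/-- `V'(r)`. -/
noncomputable def V' (t r : ℝ) : ℝ :=
  (2 * r ^ 2 * (1 - t ^ 2) ^ 2 * Real.log r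
    + (1 - r ^ 2) * ((t ^ 2 - 1) * (3 * r ^ 2 + t ^ 2)
        + 2 * (1 + 3 * r ^ 2) * t ^ 2 * Real.log t)) / (r ^ 2 * Dd t)

lemma Bp_aux (T x : ℝ) (hx : 1 < x) (hxT : x < T) :
    0 < x * ((3 * T + 1) * (T - 1)) * Real.log x
      + (1 - x) * (3 * (x - T) * (T - 1) + (1 + 3 * x) * T * Real.log T) := by
  have hT : 1 < T := hx.trans hxT
  have hL0 : 0 < Real.log T := Real.log_pos hT
  have hL1 : Real.log T ≤ T - 1 := Real.log_le_sub_one_of_pos (by linarith)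
  obtain ⟨L, hL⟩ : ∃ L, L = Real.log T := ⟨_, rfl⟩
  rw [← hL] at hL0 hL1 ⊢
  let g : ℝ → ℝ := fun y => (3 * T + 1) * (T - 1) * Real.log y
      + (3 * (T - 1) * (1 + T - T * y⁻¹ - y) + T * L * (y⁻¹ + 2 - 3 * y))
  let g' : ℝ → ℝ := fun y => (3 * T + 1) * (T - 1) * y⁻¹
      + (3 * (T - 1) * (- (T * (-(y ^ 2)⁻¹)) - 1) + T * L * (-(y ^ 2)⁻¹ - 3))
  have hd : ∀ y, 0 < y → HasDerivAt g (g' y) y := by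
    intro y hy
    have h1 := Real.hasDerivAt_log hy.ne'
    have h2 := hasDerivAt_inv hy.ne'
    have h3 := hasDerivAt_id y
    have := (h1.const_mul ((3 * T + 1) * (T - 1))).add
      (((((h2.const_mul T).const_sub (1 + T)).sub h3).const_mul (3 * (T - 1))).add
        (((h2.add_const 2).sub (h3.const_mul 3)).const_mul (T * L)))
    rw [mul_one] at this
    exact this
  have hg1 : g 1 = 0 := by simp [g]; right; norm_num
  have hgT : g T = 0 := by
    have : T ≠ 0 := by linarith
    simp only [g, ← hL]; field_simp; ring
  have hgx : x * g x = x * ((3 * T + 1) * (T - 1)) * Real.log x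
      + (1 - x) * (3 * (x - T) * (T - 1) + (1 + 3 * x) * T * L) := by
    have : x ≠ 0 := by linarith
    simp only [g]; field_simp; ring
  rw [← hgx]
  refine mul_pos (by linarith) ?_
  by_contra! hneg
  obtain ⟨a, ha, hae⟩ := exists_hasDerivAt_eq_slope g g' hx
    (fun y hy => (hd y (by linarith [hy.1])).continuousAt.continuousWithinAt)
    (fun y hy => hd y (by linarith [hy.1]))
  obtain ⟨b, hb, hbe⟩ := exists_hasDerivAt_eq_slope g g' hxT
    (fun y hy => (hd y (by linarith [hy.1])).continuousAt.continuousWithinAt)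
    (fun y hy => hd y (by linarith [hy.1]))
  have hA : g' a ≤ 0 := by
    rw [hae, hg1]; exact div_nonpos_of_nonpos_of_nonneg (by linarith) (by linarith)
  have hB : 0 ≤ g' b := by
    rw [hbe, hgT]; exact div_nonneg (by linarith) (by linarith)
  have ha0 : 0 < a := by linarith [ha.1]
  have hb0 : 0 < b := by linarith [hb.1]
  have hab : a < b := ha.2.trans hb.1
  have hq : ∀ y, 0 < y → y ^ 2 * g' y =
      -3 * (T - 1 + T * L) * y ^ 2 + (3 * T + 1) * (T - 1) * y + (3 * T * (T - 1) - T * L) := by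
    intro y hy
    simp only [g']; field_simp; ring
  have hA2 : b * (a ^ 2 * g' a) ≤ 0 :=
    mul_nonpos_of_nonneg_of_nonpos hb0.le (mul_nonpos_of_nonneg_of_nonpos (by positivity) hA)
  have hB2 : 0 ≤ a * (b ^ 2 * g' b) := by positivity
  rw [hq a ha0] at hA2
  rw [hq b hb0] at hB2
  have hk : 0 < 3 * T * (T - 1) - T * L := by nlinarith
  have hAA : 0 < 3 * (T - 1 + T * L) := by nlinarith
  have : 0 < (b - a) * (3 * (T - 1 + T * L) * (a * b) + (3 * T * (T - 1) - T * L)) := by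
    have : 0 < b - a := by linarith
    positivity
  nlinarith

/-- For `t > 1`, `B'(r) > 0` on `(1, t)`. -/
theorem Bprime_pos (t : ℝ) (ht : 1 < t) :
    ∀ r : ℝ, 1 < r → r < t → 0 < B' t r := by
  intro r hr hrt
  have ht2 : 0 < t ^ 2 - 1 := by nlinarith
  have hlt : Real.log (t ^ 2) = 2 * Real.log t := by simp
  have hlr : Real.log (r ^ 2) = 2 * Real.log r := by simp
  have hD : 0 < Dd t := by
    have h := Real.lt_log_one_add_of_pos ht2
    rw [show 1 + (t ^ 2 - 1) = t ^ 2 by ring, hlt, div_lt_iff₀ (by linarith)] at h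
    unfold Dd
    refine mul_pos (by linarith) ?_
    nlinarith
  have h := Bp_aux (t ^ 2) (r ^ 2) (by nlinarith) (by nlinarith)
  rw [hlt, hlr] at h
  unfold B'
  refine div_pos ?_ (by positivity)
  refine lt_of_lt_of_eq h ?_
  ring
end

section
/- Fix t > 1. Then the function r ↦ −A'(r)/B'(r) is strictly increasing on the interval (1, t); that is, for all 1 < r₁ < r₂ < t one has −A'(r₁)/B'(r₁) < −A'(r₂)/B'(r₂). -/
open Real Set

lemma aux_log_lower (s : ℝ) (hs : 1 < s) : 2 * (s - 1) < (s + 1) * Real.log s := by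
  have hd : ∀ x ∈ Set.Ici (1:ℝ), HasDerivAt (fun x : ℝ => (x + 1) * Real.log x - 2 * (x - 1))
      (1 * Real.log x + (x + 1) * x⁻¹ - 2 * 1) x := by
    intro x hx
    have hx' : (1:ℝ) ≤ x := hx
    exact (((hasDerivAt_id x).add_const 1).mul (Real.hasDerivAt_log (by linarith))).sub
      (((hasDerivAt_id x).sub_const 1).const_mul 2)
  have hm : StrictMonoOn (fun x : ℝ => (x + 1) * Real.log x - 2 * (x - 1)) (Set.Ici 1) := by
    apply strictMonoOn_of_deriv_pos (convex_Ici 1)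
    · intro x hx
      exact (hd x hx).continuousAt.continuousWithinAt
    · intro x hx
      rw [interior_Ici] at hx
      have hx' : (1:ℝ) < x := hx
      rw [(hd x (le_of_lt hx')).deriv]
      have h1 : 1 - x⁻¹ < Real.log x := by
        have := Real.log_lt_sub_one_of_pos (x := x⁻¹) (by positivity)
          (by intro h; rw [inv_eq_one] at h; linarith)
        rw [Real.log_inv] at this
        linarith
      have h2 : x * x⁻¹ = 1 := mul_inv_cancel₀ (by linarith)
      nlinarith
  have := hm (Set.mem_Ici.2 le_rfl) (Set.mem_Ici.2 hs.le) hs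
  simp at this
  linarith

lemma aux_log_upper (t : ℝ) (ht : 1 < t) : 2 * Real.log t * t < t ^ 2 - 1 := by
  have h := Real.self_lt_sinh_iff.2 (Real.log_pos ht)
  rw [Real.sinh_log (by linarith)] at h
  have h2 : t * t⁻¹ = 1 := mul_inv_cancel₀ (by linarith)
  nlinarith

/-- p > 0 -/
lemma aux_p_pos (s x : ℝ) (hx : 1 < x) (hxs : x < s) :
    Real.log s / (s - 1) * (x - 1) < Real.log x := by
  have h := strictConcaveOn_log_Ioi.slope_anti_adjacent (x := 1) (y := x) (z := s)
    (by simp) (by simp; linarith) hx hxs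
  rw [Real.log_one, div_lt_div_iff₀ (by linarith) (by linarith)] at h
  rw [div_mul_eq_mul_div, div_lt_iff₀ (by linarith)]
  nlinarith

noncomputable def auxG (k s x : ℝ) : ℝ :=
  Real.log x - k * (x - 1) - (1 - k * x) * ((x - 1) * (x - s)) / (x ^ 2 - s)

lemma auxG_deriv (k s x : ℝ) (hx : 0 < x) (h : x ^ 2 - s ≠ 0) :
    HasDerivAt (auxG k s)
      ((x ^ 2 - 2 * k * s * x + s) * ((x - 1) * (x - s)) / (x * (x ^ 2 - s) ^ 2)) x := by
  have hi := hasDerivAt_id x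
  have h1 := ((Real.hasDerivAt_log hx.ne').sub ((hi.sub_const 1).const_mul k)).sub
    (((((hi.const_mul k).const_sub 1)).mul ((hi.sub_const 1).mul (hi.sub_const s))).div
      ((hi.pow 2).sub_const s) h)
  refine h1.congr_deriv ?_
  simp
  field_simp
  ring

noncomputable def auxw (k s x : ℝ) : ℝ :=
  x * (Real.log x - k * (x - 1)) / ((x - 1) * (s - x))

lemma auxw_deriv (k s x : ℝ) (hx : 1 < x) (hxs : x < s) :
    HasDerivAt (auxw k s)
      (((x ^ 2 - s) * (Real.log x - k * (x - 1)) - (1 - k * x) * ((x - 1) * (x - s)))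
        / ((x - 1) * (s - x)) ^ 2) x := by
  have hi := hasDerivAt_id x
  have h0 : x ≠ 0 := by linarith
  have ha : x - 1 ≠ 0 := by linarith
  have hb : s - x ≠ 0 := by linarith
  have h1 := (hi.mul ((Real.hasDerivAt_log h0).sub ((hi.sub_const 1).const_mul k))).div
    ((hi.sub_const 1).mul (hi.const_sub s)) (mul_ne_zero ha hb)
  refine h1.congr_deriv ?_
  simp
  field_simp
  ring

lemma auxN_pos (k t x : ℝ) (ht : 1 < t) (hk0 : 0 < k) (hkt : k * t < 1)
    (hk : Real.log (t ^ 2) = k * (t ^ 2 - 1)) (hx : 1 < x) (hxs : x < t ^ 2) :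
    0 < (x ^ 2 - t ^ 2) * (Real.log x - k * (x - 1))
      - (1 - k * x) * ((x - 1) * (x - t ^ 2)) := by
  have hquad : ∀ y : ℝ, 0 < y → 0 < y ^ 2 - 2 * k * t ^ 2 * y + t ^ 2 := by
    intro y hy
    have : 0 < t * y * (1 - k * t) := by
      have : 0 < 1 - k * t := by linarith
      positivity
    nlinarith [sq_nonneg (y - t)]
  have hneg : ∀ y : ℝ, 1 < y → y < t ^ 2 → y ^ 2 - t ^ 2 ≠ 0 →
      (y ^ 2 - 2 * k * t ^ 2 * y + t ^ 2) * ((y - 1) * (y - t ^ 2))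
        / (y * (y ^ 2 - t ^ 2) ^ 2) < 0 := by
    intro y h1 h2 h3
    apply div_neg_of_neg_of_pos
    · exact mul_neg_of_pos_of_neg (hquad y (by linarith))
        (mul_neg_of_pos_of_neg (by linarith) (by linarith))
    · have : 0 < y := by linarith
      positivity
  have hG : ∀ y : ℝ, y ^ 2 - t ^ 2 ≠ 0 → (y ^ 2 - t ^ 2) * auxG k (t ^ 2) y =
      (y ^ 2 - t ^ 2) * (Real.log y - k * (y - 1))
      - (1 - k * y) * ((y - 1) * (y - t ^ 2)) := by
    intro y hy
    unfold auxG
    field_simp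
  rcases lt_trichotomy x t with hlt | heq | hgt
  · have hne : ∀ y ∈ Set.Icc 1 x, y ^ 2 - t ^ 2 ≠ 0 := by
      intro y hy
      have := hy.1
      have := hy.2
      have : y ^ 2 - t ^ 2 < 0 := by nlinarith
      exact this.ne
    have hm : StrictAntiOn (auxG k (t ^ 2)) (Set.Icc 1 x) := by
      apply strictAntiOn_of_deriv_neg (convex_Icc 1 x)
      · intro y hy
        exact (auxG_deriv k (t ^ 2) y (by linarith [hy.1])
          (hne y hy)).continuousAt.continuousWithinAt
      · intro y hy
        rw [interior_Icc] at hy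
        have hy' := Set.Ioo_subset_Icc_self hy
        rw [(auxG_deriv k (t ^ 2) y (by linarith [hy.1]) (hne y hy')).deriv]
        exact hneg y hy.1 (by linarith [hy.2]) (hne y hy')
    have h := hm (Set.left_mem_Icc.2 hx.le) (Set.right_mem_Icc.2 hx.le) hx
    have h1 : auxG k (t ^ 2) 1 = 0 := by simp [auxG]
    rw [h1] at h
    rw [← hG x (hne x (Set.right_mem_Icc.2 hx.le))]
    exact mul_pos_of_neg_of_neg (by nlinarith) h
  · subst heq
    have h1 : 0 < (1 - k * x) * ((x - 1) * (x ^ 2 - x)) :=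
      mul_pos (by linarith) (mul_pos (by linarith) (by linarith))
    nlinarith
  · have hne : ∀ y ∈ Set.Icc x (t ^ 2), y ^ 2 - t ^ 2 ≠ 0 := by
      intro y hy
      have := hy.1
      have : 0 < y ^ 2 - t ^ 2 := by nlinarith
      exact this.ne'
    have hm : StrictAntiOn (auxG k (t ^ 2)) (Set.Icc x (t ^ 2)) := by
      apply strictAntiOn_of_deriv_neg (convex_Icc _ _)
      · intro y hy
        exact (auxG_deriv k (t ^ 2) y (by linarith [hy.1])
          (hne y hy)).continuousAt.continuousWithinAt
      · intro y hy
        rw [interior_Icc] at hy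
        have hy' := Set.Ioo_subset_Icc_self hy
        rw [(auxG_deriv k (t ^ 2) y (by linarith [hy.1]) (hne y hy')).deriv]
        exact hneg y (by linarith [hy.1]) hy.2 (hne y hy')
    have h := hm (Set.left_mem_Icc.2 hxs.le) (Set.right_mem_Icc.2 hxs.le) hxs
    have h1 : auxG k (t ^ 2) (t ^ 2) = 0 := by
      unfold auxG
      rw [hk]
      simp
    rw [h1] at h
    rw [← hG x (hne x (Set.left_mem_Icc.2 hxs.le))]
    exact mul_pos (by nlinarith) h

lemma auxw_mono (k t : ℝ) (ht : 1 < t) (hk0 : 0 < k) (hkt : k * t < 1)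
    (hk : Real.log (t ^ 2) = k * (t ^ 2 - 1)) :
    StrictMonoOn (auxw k (t ^ 2)) (Set.Ioo 1 (t ^ 2)) := by
  apply strictMonoOn_of_deriv_pos (convex_Ioo _ _)
  · intro y hy
    exact (auxw_deriv k (t ^ 2) y hy.1 hy.2).continuousAt.continuousWithinAt
  · intro y hy
    rw [interior_Ioo] at hy
    rw [(auxw_deriv k (t ^ 2) y hy.1 hy.2).deriv]
    apply div_pos (auxN_pos k t y ht hk0 hkt hk hy.1 hy.2)
    have h1 : 0 < y - 1 := by linarith [hy.1]
    have h2 : 0 < t ^ 2 - y := by linarith [hy.2]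
    positivity

lemma aux_formula (k t r : ℝ) (ht : 1 < t) (hD : Dd t ≠ 0)
    (hk : 2 * Real.log t = k * (t ^ 2 - 1)) (hr : 1 < r) (hrt : r < t)
    (hden : (t ^ 2 - 1) * (3 * t ^ 2 + 1) * auxw k (t ^ 2) (r ^ 2)
        + (3 * (t ^ 2 - 1) - 2 * Real.log t) ≠ 0) :
    -A' t r / B' t r =
      t * (((t ^ 2 - 1) * (t ^ 2 + 3) * auxw k (t ^ 2) (r ^ 2)
        + (3 * (t ^ 2 - 1) - t ^ 2 * (2 * Real.log t))) /
      ((t ^ 2 - 1) * (3 * t ^ 2 + 1) * auxw k (t ^ 2) (r ^ 2)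
        + (3 * (t ^ 2 - 1) - 2 * Real.log t))) := by
  have h1 : r ^ 2 - 1 ≠ 0 := by nlinarith
  have h2 : t ^ 2 - r ^ 2 ≠ 0 := by nlinarith
  have hr0 : r ≠ 0 := by linarith
  have ht0 : t ≠ 0 := by linarith
  have hL : Real.log t = k * (t ^ 2 - 1) / 2 := by linarith
  set w := auxw k (t ^ 2) (r ^ 2) with hw
  have hlr : 2 * Real.log r * r ^ 2
      = w * ((r ^ 2 - 1) * (t ^ 2 - r ^ 2)) + k * (r ^ 2 - 1) * r ^ 2 := by
    rw [hw]
    unfold auxw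
    rw [Real.log_pow]
    field_simp
    push_cast
    ring
  have hA : A' t r = -((r ^ 2 - 1) * (t ^ 2 - r ^ 2) / (r ^ 2 * Dd t)) *
      ((t ^ 2 - 1) * (t ^ 2 + 3) * w + (3 * (t ^ 2 - 1) - t ^ 2 * (2 * Real.log t))) := by
    unfold A'
    rw [neg_mul, div_mul_eq_mul_div, ← neg_div]
    congr 1
    rw [hL]
    linear_combination (3 - 2 * t ^ 2 - t ^ 4) * hlr
  have hB : B' t r = ((r ^ 2 - 1) * (t ^ 2 - r ^ 2) / (r ^ 2 * Dd t)) / t *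
      ((t ^ 2 - 1) * (3 * t ^ 2 + 1) * w + (3 * (t ^ 2 - 1) - 2 * Real.log t)) := by
    unfold B'
    rw [div_div, div_mul_eq_mul_div]
    have : r ^ 2 * Dd t * t = r ^ 2 * t * Dd t := by ring
    rw [this]
    congr 1
    rw [hL]
    linear_combination (3 * t ^ 4 - 2 * t ^ 2 - 1) * hlr
  rw [hA, hB]
  have hc : (r ^ 2 - 1) * (t ^ 2 - r ^ 2) / (r ^ 2 * Dd t) ≠ 0 :=
    div_ne_zero (mul_ne_zero h1 h2) (mul_ne_zero (pow_ne_zero 2 hr0) hD)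
  generalize (r ^ 2 - 1) * (t ^ 2 - r ^ 2) / (r ^ 2 * Dd t) = c at hc
  generalize (t ^ 2 - 1) * (3 * t ^ 2 + 1) * w + (3 * (t ^ 2 - 1) - 2 * Real.log t) = d at hden
  field_simp

/-- For `t > 1`, the function `r ↦ −A'(r)/B'(r)` is strictly increasing on `(1, t)`. -/
theorem neg_Aprime_div_Bprime_strictMono (t : ℝ) (ht : 1 < t) :
    ∀ r₁ r₂ : ℝ, 1 < r₁ → r₁ < r₂ → r₂ < t →
      -A' t r₁ / B' t r₁ < -A' t r₂ / B' t r₂ := by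
  intro r₁ r₂ h1 h12 h2
  have hs : 0 < t ^ 2 - 1 := by nlinarith
  have hlog : Real.log (t ^ 2) = 2 * Real.log t := by rw [Real.log_pow]; norm_num
  have hlow := aux_log_lower (t ^ 2) (by linarith)
  rw [hlog] at hlow
  have hup := aux_log_upper t ht
  have hLpos := Real.log_pos ht
  have hDpos : 0 < Dd t := by
    unfold Dd
    have : 0 < 1 - t ^ 2 + (1 + t ^ 2) * Real.log t := by linarith
    positivity
  obtain ⟨k, hkdef⟩ : ∃ k, k = 2 * Real.log t / (t ^ 2 - 1) := ⟨_, rfl⟩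
  have hk : 2 * Real.log t = k * (t ^ 2 - 1) := by rw [hkdef]; field_simp
  have hk0 : 0 < k := by rw [hkdef]; positivity
  have hkt : k * t < 1 := by
    rw [hkdef, div_mul_eq_mul_div, div_lt_one hs]; exact hup
  have hwpos : ∀ r, 1 < r → r < t → 0 < auxw k (t ^ 2) (r ^ 2) := by
    intro r hr hrt
    have a1 : 1 < r ^ 2 := by nlinarith
    have a2 : r ^ 2 < t ^ 2 := by nlinarith
    have hp := aux_p_pos (t ^ 2) (r ^ 2) a1 a2
    rw [hlog, ← hkdef] at hp
    unfold auxw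
    apply div_pos
    · exact mul_pos (by linarith) (by linarith)
    · exact mul_pos (by linarith) (by linarith)
  have hc : 0 < 3 * (t ^ 2 - 1) - 2 * Real.log t := by nlinarith
  have hdpos : ∀ r, 1 < r → r < t → 0 < (t ^ 2 - 1) * (3 * t ^ 2 + 1) * auxw k (t ^ 2) (r ^ 2)
        + (3 * (t ^ 2 - 1) - 2 * Real.log t) := by
    intro r hr hrt
    have := hwpos r hr hrt
    positivity
  have d1 := hdpos r₁ h1 (by linarith)
  have d2 := hdpos r₂ (by linarith) h2
  rw [aux_formula k t r₁ ht hDpos.ne' hk h1 (by linarith) d1.ne',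
    aux_formula k t r₂ ht hDpos.ne' hk (by linarith) h2 d2.ne']
  have hw : auxw k (t ^ 2) (r₁ ^ 2) < auxw k (t ^ 2) (r₂ ^ 2) := by
    apply auxw_mono k t ht hk0 hkt (by rw [hlog, hk])
    · constructor <;> nlinarith
    · constructor <;> nlinarith
    · nlinarith
  apply mul_lt_mul_of_pos_left _ (by linarith)
  rw [div_lt_div_iff₀ d1 d2]
  generalize auxw k (t ^ 2) (r₁ ^ 2) = w1 at *
  generalize auxw k (t ^ 2) (r₂ ^ 2) = w2 at *
  have hdet : 0 < 3 * (t ^ 2 - 1) ^ 2 * ((t ^ 2 + 1) * (2 * Real.log t) - 2 * (t ^ 2 - 1))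
      * (w2 - w1) := by
    apply mul_pos (mul_pos (by positivity) (by linarith)) (by linarith)
  rw [← sub_pos]
  refine lt_of_lt_of_eq hdet ?_
  ring
end

section
/- For every real t > 1, one has σ₀(t) < (1 + t²)/(2t), where σ₀(t) = t(3 − 4t² + t⁴ + 4t²·log t)/(2 − 2t² + log t + 3t⁴·log t). -/
/-- The bi-harmonic critical bound `σ₀(t)` is smaller than the harmonic Nitsche bound
`n(t) = (1 + t²)/(2t)`. -/
theorem sigma0_lt_nitsche (t : ℝ) (ht : 1 < t) :
    t * (3 - 4 * t ^ 2 + t ^ 4 + 4 * t ^ 2 * Real.log t) /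
        (2 - 2 * t ^ 2 + Real.log t + 3 * t ^ 4 * Real.log t)
      < (1 + t ^ 2) / (2 * t) := by
  have hx : 1 < t ^ 2 := by nlinarith
  have h := Real.le_log_one_add_of_nonneg (x := t ^ 2 - 1) (by linarith)
  rw [add_sub_cancel, Real.log_pow, div_le_iff₀ (by linarith)] at h
  push_cast at h
  have e4 : t ^ 4 = (t ^ 2) ^ 2 := by ring
  have h0 : 0 < t := by linarith
  generalize Real.log t = L at *
  have key : ∀ x : ℝ, 1 < x → 2 * (x - 1) ≤ 2 * L * (x - 1 + 2) →
      0 < 2 - 2 * x + L + 3 * x ^ 2 * L ∧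
      2 * x * (3 - 4 * x + x ^ 2 + 4 * x * L) < (1 + x) * (2 - 2 * x + L + 3 * x ^ 2 * L) := by
    intro x hx h
    have hL : (x - 1) / (x + 1) ≤ L := by
      rw [div_le_iff₀ (by linarith)]; linarith
    have hL0 : 0 < L := lt_of_lt_of_le (div_pos (by linarith) (by linarith)) hL
    have h1 : 0 < L * (3 * x + 1) - 2 * (x - 1) := by
      nlinarith [mul_pos hL0 (sub_pos.2 hx)]
    constructor
    · nlinarith [mul_pos hL0 (mul_pos (sub_pos.2 hx) (by linarith : (0:ℝ) < x))]
    · have := mul_pos (pow_pos (sub_pos.2 hx) 2) h1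
      nlinarith
  obtain ⟨hD, hN⟩ := key (t ^ 2) hx h
  rw [e4, div_lt_div_iff₀ hD (by linarith)]
  calc _ = 2 * t ^ 2 * (3 - 4 * t ^ 2 + (t ^ 2) ^ 2 + 4 * t ^ 2 * L) := by ring
    _ < _ := hN
end
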